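/- arXiv:math/0609121 — 2 statements merged into one kernel-verified Lean document; each statement's English description precedes it below -/
import Mathlib

section
/- Every finite set D of non-positive integers that contains 0 and at least one negative integer is the signed degree set of some connected signed graph. -/
/-- A signed graph on a vertex type `V`: a simple graph in which every edge is
assigned a sign, encoded as two edge-disjoint simple graphs, the graph of
positive edges and the graph of negative edges. -/
structure SignedGraph (V : Type*) where
  pos : SimpleGraph V
  neg : SimpleGraph V
  disjoint : ∀ u v : V, ¬(pos.Adj u v ∧ neg.Adj u v)

namespace SignedGraph

variable {V : Type*}

/-- The underlying simple graph of a signed graph. -/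
def underlying (G : SignedGraph V) : SimpleGraph V := G.pos ⊔ G.neg

/-- A signed graph is connected if its underlying simple graph is connected. -/
def Connected (G : SignedGraph V) : Prop := G.underlying.Connected

/-- The signed degree of a vertex: the number of positive edges incident with it
minus the number of negative edges incident with it. -/
noncomputable def sdeg (G : SignedGraph V) (v : V) : ℤ :=
  (Nat.card {u : V // G.pos.Adj v u} : ℤ) - (Nat.card {u : V // G.neg.Adj v u} : ℤ)

/-- The signed degree set of a signed graph: the set of distinct signed degrees
of its vertices. -/
def degreeSet (G : SignedGraph V) : Set ℤ := Set.range G.sdeg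

end SignedGraph

/-- Transport of a signed graph on a finite type to `Fin n`. -/
theorem SignedGraph.exists_fin {V : Type} [Finite V] (G : SignedGraph V) (hG : G.Connected) :
    ∃ (n : ℕ) (H : SignedGraph (Fin n)), H.Connected ∧ H.degreeSet = G.degreeSet := by
  obtain ⟨n, ⟨e⟩⟩ := Finite.exists_equiv_fin V
  refine ⟨n, ⟨G.pos.comap e.symm, G.neg.comap e.symm, fun u v => G.disjoint _ _⟩, ?_, ?_⟩
  · have f : G.underlying ≃g (G.pos.comap e.symm ⊔ G.neg.comap e.symm) :=
      ⟨e, by intro a b; simp [SignedGraph.underlying]⟩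
    exact f.connected_iff.1 hG
  · have key : ∀ v, SignedGraph.sdeg ⟨G.pos.comap e.symm, G.neg.comap e.symm,
        fun u v => G.disjoint _ _⟩ v = G.sdeg (e.symm v) := by
      intro v
      unfold SignedGraph.sdeg
      congr 2
      · exact Nat.card_congr (e.symm.subtypeEquiv (by intro a; simp))
      · exact Nat.card_congr (e.symm.subtypeEquiv (by intro a; simp))
    ext x
    simp only [SignedGraph.degreeSet, Set.mem_range, key]
    exact (e.symm.surjective.exists (p := fun y => G.sdeg y = x)).symm

/-- One block `Bool × ZMod (m+1)` for each `d ∈ D`; inside the block a bipartite `|d|`-regular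
negative graph, between blocks a complete graph with balanced signs. -/
def blockGraph (D : Finset ℤ) (m : ℕ) : SignedGraph (D × Bool × ZMod (m + 1)) where
  pos :=
    { Adj := fun u v => u.1 ≠ v.1 ∧ u.2.1 = v.2.1
      symm := ⟨fun _ _ h => ⟨h.1.symm, h.2.symm⟩⟩
      loopless := ⟨fun _ h => h.1 rfl⟩ }
  neg :=
    { Adj := fun u v => u.2.1 ≠ v.2.1 ∧
        (u.1 = v.1 → (u.2.2 + v.2.2).val < (u.1 : ℤ).natAbs)
      symm := ⟨fun u v h => ⟨h.1.symm, fun e => by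
        have := h.2 e.symm
        rwa [add_comm u.2.2, ← e] at this⟩⟩
      loopless := ⟨fun _ h => h.1 rfl⟩ }
  disjoint := fun _ _ h => h.2.1 h.1.2

theorem blockGraph_sdeg (D : Finset ℤ) (m : ℕ) (hm : ∀ d ∈ D, d.natAbs ≤ m)
    (hD : ∀ d ∈ D, d ≤ 0) (v : D × Bool × ZMod (m + 1)) :
    (blockGraph D m).sdeg v = v.1 := by
  obtain ⟨d, b, i⟩ := v
  have hd := hm d d.2
  have hd' := hD d d.2
  have hval : ∀ x : Fin (d : ℤ).natAbs, ((x : ℕ) : ZMod (m + 1)).val = x := fun x =>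
    ZMod.val_cast_of_lt (by have := x.2; omega)
  let f : Fin (d : ℤ).natAbs ⊕ {u // (blockGraph D m).pos.Adj (d, b, i) u} →
      {u // (blockGraph D m).neg.Adj (d, b, i) u} := fun s =>
    match s with
    | Sum.inl x => ⟨(d, !b, ((x : ℕ) : ZMod (m + 1)) - i), by
        refine ⟨by simp, fun _ => ?_⟩
        simp [hval]⟩
    | Sum.inr u => ⟨(u.1.1, !u.1.2.1, u.1.2.2), by
        obtain ⟨u, h1, h2⟩ := u
        refine ⟨?_, fun h => absurd h h1⟩
        simp at h2
        simp [h2]⟩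
  have hf : Function.Bijective f := by
    constructor
    · rintro (x | ⟨⟨d1, b1, i1⟩, h1, h1'⟩) (y | ⟨⟨d2, b2, i2⟩, h2, h2'⟩) h
      · replace h := congrArg Subtype.val h
        simp only [f, Prod.mk.injEq, true_and, sub_left_inj] at h
        have := congrArg ZMod.val h
        rw [hval, hval] at this
        exact congrArg _ (Fin.ext this)
      · replace h := congrArg Subtype.val h
        simp only [f, Prod.mk.injEq] at h
        exact absurd h.1 h2
      · replace h := congrArg Subtype.val h
        simp only [f, Prod.mk.injEq] at h
        exact absurd h.1.symm h1
      · replace h := congrArg Subtype.val h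
        simp only [f, Prod.mk.injEq] at h
        obtain ⟨rfl, hb, rfl⟩ := h
        have : b1 = b2 := by simpa using hb
        subst this
        rfl
    · rintro ⟨⟨d1, b1, i1⟩, h1, h2⟩
      have hb : (!b) = b1 := by
        simp only at h1
        revert h1; cases b <;> cases b1 <;> simp
      by_cases h : d = d1
      · subst h
        refine ⟨Sum.inl ⟨(i + i1).val, h2 rfl⟩, ?_⟩
        simp [f, hb]
      · refine ⟨Sum.inr ⟨(d1, b, i1), h, rfl⟩, ?_⟩
        simp [f, hb]
  have hc := Nat.card_eq_of_bijective f hf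
  rw [Nat.card_sum, Nat.card_fin] at hc
  unfold SignedGraph.sdeg
  rw [← hc]
  push_cast
  rw [abs_of_nonpos hd']
  ring

theorem blockGraph_connected (D : Finset ℤ) (m : ℕ) (hD : ∀ d : D, ∃ d' : D, d ≠ d')
    (hne : Nonempty D) : (blockGraph D m).Connected := by
  have adj : ∀ u v : D × Bool × ZMod (m + 1), u.1 ≠ v.1 →
      (blockGraph D m).underlying.Reachable u v := by
    intro u v h
    apply SimpleGraph.Adj.reachable
    by_cases hb : u.2.1 = v.2.1
    · exact Or.inl ⟨h, hb⟩
    · exact Or.inr ⟨hb, fun e => absurd e h⟩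
  have : Nonempty (D × Bool × ZMod (m + 1)) := ⟨(hne.some, true, 0)⟩
  refine SimpleGraph.Connected.mk (fun u v => ?_)
  by_cases h : u.1 = v.1
  · obtain ⟨d', hd'⟩ := hD u.1
    exact (adj u (d', true, 0) hd').trans (adj _ v (by rw [← h]; exact hd'.symm))
  · exact adj u v h

/-- Every finite set of non-positive integers containing `0` and at least one
negative integer is the signed degree set of some connected signed graph. -/
theorem stmt_9 (D : Finset ℤ) (h0 : (0 : ℤ) ∈ D) (hnonpos : ∀ d ∈ D, d ≤ 0)
    (hneg : ∃ d ∈ D, d < 0) :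
    ∃ (n : ℕ) (G : SignedGraph (Fin n)), G.Connected ∧ G.degreeSet = ↑D := by
  obtain ⟨a, ha, ha0⟩ := hneg
  have hm : ∀ d ∈ D, d.natAbs ≤ D.sup Int.natAbs := fun d hd => Finset.le_sup (f := Int.natAbs) hd
  have hconn : (blockGraph D (D.sup Int.natAbs)).Connected := by
    refine blockGraph_connected D _ (fun d => ?_) ⟨⟨0, h0⟩⟩
    by_cases h : (d : ℤ) = 0
    · exact ⟨⟨a, ha⟩, fun e => by have := congrArg Subtype.val e; simp only at this; omega⟩
    · exact ⟨⟨0, h0⟩, fun e => h (congrArg Subtype.val e)⟩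
  obtain ⟨n, H, hH, hdeg⟩ := SignedGraph.exists_fin _ hconn
  refine ⟨n, H, hH, hdeg.trans ?_⟩
  ext x
  simp only [SignedGraph.degreeSet, Set.mem_range, blockGraph_sdeg D _ hm hnonpos]
  constructor
  · rintro ⟨v, rfl⟩
    exact v.1.2
  · intro hx
    exact ⟨(⟨x, hx⟩, true, 0), rfl⟩
end

section
/- Let G1 and G2 be disjoint connected signed graphs, let uv be a positive edge of G1 and let xy be a negative edge of G2. The signed graph G obtained from the disjoint union of G1 and G2 by adding the positive edges ux and vy and the negative edges uy and vx is a connected signed graph in which every vertex has the same signed degree as it had in G1 or G2; hence the signed degree set of G is the union of the signed degree sets of G1 and G2. -/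
theorem card_sum_subtype {A B : Type*} [Finite A] [Finite B] (P : A ⊕ B → Prop) :
    Nat.card {w // P w} = Nat.card {a // P (Sum.inl a)} + Nat.card {b // P (Sum.inr b)} := by
  rw [← Nat.card_sum]
  exact Nat.card_congr Equiv.subtypeSum

theorem card_cross {A B : Type*} (u v p : A) (huv : u ≠ v) (x y : B) :
    Nat.card {b : B // (p = u ∧ b = x) ∨ (p = v ∧ b = y)} =
      Nat.card {b : B // (p = u ∧ b = y) ∨ (p = v ∧ b = x)} := by
  by_cases h1 : p = u
  · subst h1
    simp [huv]
  · by_cases h2 : p = v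
    · subst h2
      simp [h1]
    · simp [h1, h2]

/-- Joining two disjoint connected signed graphs `G1` (with a positive edge `uv`)
and `G2` (with a negative edge `xy`) by the positive edges `ux, vy` and the
negative edges `uy, vx` yields a connected signed graph in which every vertex
keeps its signed degree; hence its signed degree set is the union of the two
signed degree sets. -/
theorem stmt_16 {V1 V2 : Type*} [Fintype V1] [Fintype V2]
    (G1 : SignedGraph V1) (G2 : SignedGraph V2)
    (hG1conn : G1.Connected) (hG2conn : G2.Connected)
    (u v : V1) (huv : G1.pos.Adj u v) (x y : V2) (hxy : G2.neg.Adj x y)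
    (G : SignedGraph (V1 ⊕ V2))
    (hpos : ∀ a b, G.pos.Adj a b ↔
      (∃ p q, a = Sum.inl p ∧ b = Sum.inl q ∧ G1.pos.Adj p q) ∨
      (∃ p q, a = Sum.inr p ∧ b = Sum.inr q ∧ G2.pos.Adj p q) ∨
      (a = Sum.inl u ∧ b = Sum.inr x) ∨ (a = Sum.inr x ∧ b = Sum.inl u) ∨
      (a = Sum.inl v ∧ b = Sum.inr y) ∨ (a = Sum.inr y ∧ b = Sum.inl v))
    (hneg : ∀ a b, G.neg.Adj a b ↔
      (∃ p q, a = Sum.inl p ∧ b = Sum.inl q ∧ G1.neg.Adj p q) ∨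
      (∃ p q, a = Sum.inr p ∧ b = Sum.inr q ∧ G2.neg.Adj p q) ∨
      (a = Sum.inl u ∧ b = Sum.inr y) ∨ (a = Sum.inr y ∧ b = Sum.inl u) ∨
      (a = Sum.inl v ∧ b = Sum.inr x) ∨ (a = Sum.inr x ∧ b = Sum.inl v)) :
    G.Connected ∧
      (∀ p : V1, G.sdeg (Sum.inl p) = G1.sdeg p) ∧
      (∀ q : V2, G.sdeg (Sum.inr q) = G2.sdeg q) ∧
      G.degreeSet = G1.degreeSet ∪ G2.degreeSet := by
  have hl : ∀ p : V1, G.sdeg (Sum.inl p) = G1.sdeg p := by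
    intro p
    unfold SignedGraph.sdeg
    rw [card_sum_subtype, card_sum_subtype]
    have h := card_cross u v p huv.ne x y
    simp only [hpos, hneg]
    simp
    rw [h]
    ring
  have hr : ∀ q : V2, G.sdeg (Sum.inr q) = G2.sdeg q := by
    intro q
    unfold SignedGraph.sdeg
    rw [card_sum_subtype, card_sum_subtype]
    have h := card_cross x y q hxy.ne u v
    have h2 : Nat.card {a : V1 // (q = y ∧ a = u) ∨ (q = x ∧ a = v)} =
        Nat.card {a : V1 // (q = x ∧ a = v) ∨ (q = y ∧ a = u)} :=
      Nat.card_congr (Equiv.subtypeEquivRight fun a => or_comm)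
    simp only [hpos, hneg]
    simp
    rw [h2, h]
    ring
  refine ⟨?_, hl, hr, ?_⟩
  · let f1 : G1.underlying →g G.underlying := ⟨Sum.inl, by
      intro a b hab
      rcases hab with hab | hab
      · exact Or.inl ((hpos _ _).2 (Or.inl ⟨a, b, rfl, rfl, hab⟩))
      · exact Or.inr ((hneg _ _).2 (Or.inl ⟨a, b, rfl, rfl, hab⟩))⟩
    let f2 : G2.underlying →g G.underlying := ⟨Sum.inr, by
      intro a b hab
      rcases hab with hab | hab
      · exact Or.inl ((hpos _ _).2 (Or.inr (Or.inl ⟨a, b, rfl, rfl, hab⟩)))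
      · exact Or.inr ((hneg _ _).2 (Or.inr (Or.inl ⟨a, b, rfl, rfl, hab⟩)))⟩
    have hux : G.underlying.Adj (Sum.inl u) (Sum.inr x) :=
      Or.inl ((hpos _ _).2 (Or.inr (Or.inr (Or.inl ⟨rfl, rfl⟩))))
    have key : ∀ w, G.underlying.Reachable (Sum.inl u) w := by
      rintro (a | b)
      · exact (hG1conn.preconnected u a).map f1
      · exact hux.reachable.trans ((hG2conn.preconnected x b).map f2)
    haveI : Nonempty (V1 ⊕ V2) := ⟨Sum.inl u⟩
    exact SimpleGraph.Connected.mk fun a b => (key a).symm.trans (key b)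
  · ext d
    simp [SignedGraph.degreeSet, hl, hr]
end
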